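/- arXiv:1903.09904 — 2 statements merged into one kernel-verified Lean document; each statement's English description precedes it below -/
import Mathlib

section
/- Let u₁, …, u_l and x₁, …, x_l be families of linearly independent vectors in V with B(u_i, u_j) = 0 and B(x_i, x_j) = 0 for all i, j, and let a₁, …, a_l, b₁, …, b_l ∈ k be nonzero. Set τ_{U,a} = τ_{u_l,a_l} ∘ ⋯ ∘ τ_{u_1,a_1} and τ_{X,b} = τ_{x_l,b_l} ∘ ⋯ ∘ τ_{x_1,b_1}, and assume both are involutions in Sp(B,k). Then there exists φ ∈ Sp(B,k) with φ ∘ τ_{U,a} ∘ φ⁻¹ = τ_{X,b} if and only if there exists a family x'₁, …, x'_l of vectors with span{x'₁,…,x'_l} = span{x₁,…,x_l} such that, writing x'_i = Σ_j α_{ji}·x_j, the coefficients satisfy b_j = Σ_i a_i·α_{ji}² for all j, and Σ_i a_i·α_{ji}·α_{mi} = 0 for all j ≠ m. -/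
open QuadraticMap

/-- The symplectic transvection `τ_{u,a} : w ↦ w + a·B(u,w)·u`, where `B = polar Q` is the
bilinear form associated to the quadratic form `Q`. -/
noncomputable def sympTransvection {k V : Type*} [Field k] [AddCommGroup V] [Module k V]
    (Q : QuadraticForm k V) (u : V) (a : k) : Module.End k V :=
  LinearMap.id + a • (polarBilin Q u).smulRight u

namespace LinearMap.BilinForm

variable {k V : Type*} [Field k] [AddCommGroup V] [Module k V] {B : LinearMap.BilinForm k V}

/-- A nondegenerate form takes arbitrary prescribed values against a linearly independent
family. -/
theorem Nondegenerate.exists_apply_eq [FiniteDimensional k V] (hB : B.Nondegenerate)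
    {ι : Type*} {v : ι → V} (hv : LinearIndependent k v) (c : ι → k) :
    ∃ w, ∀ i, B w (v i) = c i := by
  obtain ⟨g, hg⟩ := (Finsupp.linearCombination k v).exists_leftInverse_of_injective
    (LinearMap.ker_eq_bot.2 hv)
  refine ⟨(B.toDual hB).symm (Finsupp.linearCombination k c ∘ₗ g), fun i ↦ ?_⟩
  have hgi : g (v i) = Finsupp.single i 1 := by
    simpa using LinearMap.congr_fun hg (Finsupp.single i 1)
  simp [apply_toDual_symm_apply, hgi]

/-- Two vectors which pair nontrivially are related by a symplectic transvection which fixes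
every vector pairing equally with both. -/
theorem IsAlt.exists_isometry_of_apply_ne_zero (hB : B.IsAlt) {p q : V} (hpq : B q p ≠ 0) :
    ∃ φ : V ≃ₗ[k] V, (∀ v w, B (φ v) (φ w) = B v w) ∧ φ p = q ∧
      ∀ s, B p s = B q s → φ s = s := by
  have hf : ((B q p)⁻¹ • B (p - q)) (p - q) = 0 := by
    rw [LinearMap.smul_apply, hB.self_eq_zero, smul_zero]
  have apply (w : V) : LinearEquiv.transvection hf w =
      w + ((B q p)⁻¹ * B (p - q) w) • (p - q) := rfl
  refine ⟨LinearEquiv.transvection hf, fun v w ↦ ?_, ?_, fun s hs ↦ ?_⟩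
  · have hv : B v (p - q) = -B (p - q) v := (hB.neg_eq v (p - q)).symm ▸ by simp
    simp only [apply, map_add, map_smul, LinearMap.add_apply, LinearMap.smul_apply,
      smul_eq_mul, hB.self_eq_zero, hv]
    ring
  · rw [apply]
    simp [hB.self_eq_zero, hpq]
  · rw [apply]
    simp [hs]

/-- Transitivity on vectors of the stabilizer of an orthogonal family, in a symplectic group. -/
theorem IsAlt.exists_isometry_fixing (hB : B.IsAlt) {ι : Type*} {s : ι → V} {p q y z : V}
    (hp : ∀ i, B p (s i) = 0) (hq : ∀ i, B q (s i) = 0)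
    (hy : ∀ i, B y (s i) = 0) (hz : ∀ i, B z (s i) = 0)
    (hyp : B y p ≠ 0) (hzq : B z q ≠ 0) :
    ∃ φ : V ≃ₗ[k] V, (∀ v w, B (φ v) (φ w) = B v w) ∧ φ p = q ∧ ∀ i, φ (s i) = s i := by
  obtain ⟨t, ht, htp, htq⟩ : ∃ t, (∀ i, B t (s i) = 0) ∧ B t p ≠ 0 ∧ B t q ≠ 0 := by
    by_cases hyq : B y q = 0
    · by_cases hzp : B z p = 0
      · exact ⟨y + z, fun i ↦ by simp [hy, hz], by simpa [hzp], by simpa [hyq]⟩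
      · exact ⟨z, hz, hzp, hzq⟩
    · exact ⟨y, hy, hyp, hyq⟩
  have hqt : B q t ≠ 0 := fun h ↦ htq (by rw [← hB.neg_eq, h, neg_zero])
  obtain ⟨φ, hφ, hφp, hφs⟩ := hB.exists_isometry_of_apply_ne_zero htp
  obtain ⟨ψ, hψ, hψt, hψs⟩ := hB.exists_isometry_of_apply_ne_zero hqt
  refine ⟨φ.trans ψ, fun v w ↦ by simp [hφ, hψ], by simp [hφp, hψt], fun i ↦ ?_⟩
  simp [hφs (s i) (by rw [hp, ht]), hψs (s i) (by rw [ht, hq])]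

/-- Witt's theorem for totally isotropic families in a symplectic space. -/
theorem IsAlt.exists_isometry_apply_eq [FiniteDimensional k V] (hB : B.IsAlt)
    (hnd : B.Nondegenerate) {n : ℕ} {u x : Fin n → V}
    (hu : LinearIndependent k u) (hx : LinearIndependent k x)
    (huB : ∀ i j, B (u i) (u j) = 0) (hxB : ∀ i j, B (x i) (x j) = 0) :
    ∃ φ : V ≃ₗ[k] V, (∀ v w, B (φ v) (φ w) = B v w) ∧ ∀ i, φ (u i) = x i := by
  induction n with
  | zero => exact ⟨LinearEquiv.refl k V, fun _ _ ↦ rfl, fun i ↦ i.elim0⟩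
  | succ n ih =>
    obtain ⟨φ, hφ, hφu⟩ := ih (hu.comp _ (Fin.castSucc_injective n))
      (hx.comp _ (Fin.castSucc_injective n)) (fun _ _ ↦ huB _ _) (fun _ _ ↦ hxB _ _)
    have hφu' (i : Fin n) : φ (u i.castSucc) = x i.castSucc := hφu i
    obtain ⟨y, hy⟩ := hnd.exists_apply_eq (hu.map' φ.toLinearMap φ.ker)
      (Pi.single (Fin.last n) 1)
    obtain ⟨z, hz⟩ := hnd.exists_apply_eq hx (Pi.single (Fin.last n) 1)
    obtain ⟨ψ, hψ, hψp, hψs⟩ := hB.exists_isometry_fixing (s := fun i : Fin n ↦ x i.castSucc)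
      (p := φ (u (Fin.last n))) (q := x (Fin.last n)) (y := y) (z := z)
      (fun i ↦ by rw [← hφu', hφ, huB]) (fun i ↦ hxB _ _)
      (fun i ↦ by
        rw [← hφu']
        exact (hy i.castSucc).trans (by simp [(Fin.castSucc_lt_last i).ne]))
      (fun i ↦ by rw [hz]; simp [(Fin.castSucc_lt_last i).ne])
      (fun h ↦ one_ne_zero (((hy (Fin.last n)).symm.trans h ▸ by simp) : (1 : k) = 0))
      (by simp [hz])
    refine ⟨φ.trans ψ, fun v w ↦ by simp [hφ, hψ], fun i ↦ ?_⟩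
    induction i using Fin.lastCases with
    | last => simpa using hψp
    | cast i => simpa [hφu'] using hψs i

end LinearMap.BilinForm

section SympTransvection

variable {k V : Type*} [Field k] [AddCommGroup V] [Module k V] (Q : QuadraticForm k V)

theorem sympTransvection_apply (u : V) (a : k) (w : V) :
    sympTransvection Q u a w = w + (a * polar Q u w) • u := by
  simp [sympTransvection, mul_smul]

theorem prod_reverse_ofFn_sympTransvection_apply {l : ℕ} (u : Fin l → V) (a : Fin l → k)
    (huB : ∀ i j, polar Q (u i) (u j) = 0) (w : V) :
    (List.ofFn fun i => sympTransvection Q (u i) (a i)).reverse.prod w =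
      w + ∑ i, (a i * polar Q (u i) w) • u i := by
  induction l generalizing w with
  | zero => simp
  | succ l ih =>
    rw [List.ofFn_succ, List.reverse_cons, List.prod_append, List.prod_singleton,
      Module.End.mul_apply, sympTransvection_apply,
      ih (fun i ↦ u i.succ) (fun i ↦ a i.succ) (fun _ _ ↦ huB _ _), Fin.sum_univ_succ]
    simp [huB, polar_add_right, polar_smul_right, add_assoc]

theorem sum_polar_smul_linearCombination {l : ℕ} (x x' : Fin l → V) (a : Fin l → k)
    (α : Fin l → Fin l → k) (hx' : ∀ i, x' i = ∑ j, α j i • x j) (w : V) :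
    ∑ i, (a i * polar Q (x' i) w) • x' i =
      ∑ m, (∑ j, (∑ i, a i * α j i * α m i) * polar Q (x j) w) • x m := by
  have hpolar (i : Fin l) : polar Q (x' i) w = ∑ j, α j i * polar Q (x j) w := by
    simp only [← polarBilin_apply_apply, hx' i, map_sum, map_smul, LinearMap.sum_apply,
      LinearMap.smul_apply, smul_eq_mul]
  calc
    _ = ∑ i, ∑ m, (a i * polar Q (x' i) w * α m i) • x m := by
      refine Finset.sum_congr rfl fun i _ ↦ ?_
      refine (congrArg ((a i * polar Q (x' i) w) • ·) (hx' i)).trans ?_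
      simp only [Finset.smul_sum, smul_smul]
    _ = ∑ m, ∑ i, (a i * polar Q (x' i) w * α m i) • x m := Finset.sum_comm
    _ = _ := by
      refine Finset.sum_congr rfl fun m _ ↦ ?_
      rw [← Finset.sum_smul]
      congr 1
      simp only [hpolar, Finset.mul_sum, Finset.sum_mul]
      rw [Finset.sum_comm]
      exact Finset.sum_congr rfl fun j _ ↦ Finset.sum_congr rfl fun i _ ↦ by ring

end SympTransvection

/-- two diagonal symplectic involutions `τ_{U,a}` and `τ_{X,b}` are
`Sp(B,k)`-conjugate iff there is a family `x'` spanning the same subspace as `X` whose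
change-of-basis coefficients relative to `X` make `(X',a)` involution compatible with
`(X,b)`. -/
theorem sympTransvection_products_conjugate_iff
    {k V : Type*} [Field k] [CharP k 2] [AddCommGroup V] [Module k V] [FiniteDimensional k V]
    (Q : QuadraticForm k V)
    -- `V` is nonsingular
    (hns : ∀ v : V, (∀ w : V, polar Q v w = 0) → v = 0)
    {l : ℕ} (u x : Fin l → V) (a b : Fin l → k)
    (hu : LinearIndependent k u) (hx : LinearIndependent k x)
    (huB : ∀ i j, polar Q (u i) (u j) = 0) (hxB : ∀ i j, polar Q (x i) (x j) = 0)
    (ha : ∀ i, a i ≠ 0) (hb : ∀ i, b i ≠ 0)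
    -- both maps are involutions in `Sp(B,k)`
    (hUinv : (List.ofFn fun i => sympTransvection Q (u i) (a i)).reverse.prod *
      (List.ofFn fun i => sympTransvection Q (u i) (a i)).reverse.prod = 1)
    (hXinv : (List.ofFn fun i => sympTransvection Q (x i) (b i)).reverse.prod *
      (List.ofFn fun i => sympTransvection Q (x i) (b i)).reverse.prod = 1) :
    (∃ φ : V ≃ₗ[k] V, (∀ v w : V, polar Q (φ v) (φ w) = polar Q v w) ∧
      φ.toLinearMap ∘ₗ (List.ofFn fun i => sympTransvection Q (u i) (a i)).reverse.prod ∘ₗ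
          φ.symm.toLinearMap =
        (List.ofFn fun i => sympTransvection Q (x i) (b i)).reverse.prod) ↔
    (∃ x' : Fin l → V,
      Submodule.span k (Set.range x') = Submodule.span k (Set.range x) ∧
      ∃ α : Fin l → Fin l → k,
        (∀ i, x' i = ∑ j, α j i • x j) ∧
        (∀ j, b j = ∑ i, a i * (α j i) ^ 2) ∧
        (∀ j m, j ≠ m → ∑ i, a i * α j i * α m i = 0)) := by
  have hself (v : V) : polar Q v v = 0 := by
    rw [polar_self, two_smul, CharTwo.add_self_eq_zero]
  have hB : LinearMap.BilinForm.IsAlt (polarBilin Q) := hself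
  have hnd : LinearMap.BilinForm.Nondegenerate (polarBilin Q) :=
    hB.isRefl.nondegenerate_iff_separatingLeft.2 hns
  constructor
  · rintro ⟨φ, hφ, hconj⟩
    have key (w : V) : ∑ i, (a i * polar Q (φ (u i)) w) • φ (u i) =
        ∑ j, (b j * polar Q (x j) w) • x j := by
      have h := LinearMap.congr_fun hconj w
      simp only [LinearMap.comp_apply, LinearEquiv.coe_coe,
        prod_reverse_ofFn_sympTransvection_apply Q u a huB,
        prod_reverse_ofFn_sympTransvection_apply Q x b hxB, map_add, map_sum, map_smul,
        LinearEquiv.apply_symm_apply, add_right_inj] at h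
      rw [← h]
      refine Finset.sum_congr rfl fun i _ ↦ ?_
      rw [← hφ (u i), LinearEquiv.apply_symm_apply]
    have hdual (j : Fin l) : ∃ w, ∀ i, polar Q (x i) w = if i = j then 1 else 0 := by
      obtain ⟨w, hw⟩ := hnd.exists_apply_eq hx fun i ↦ if i = j then 1 else 0
      exact ⟨w, fun i ↦ (polar_comm Q _ _).trans (hw i)⟩
    have hφu : LinearIndependent k (φ ∘ u) := hu.map' φ.toLinearMap φ.ker
    have hspan : Submodule.span k (Set.range (φ ∘ u)) = Submodule.span k (Set.range x) := by
      refine (Submodule.eq_of_le_of_finrank_eq ?_ ?_).symm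
      · rw [Submodule.span_le]
        rintro _ ⟨j, rfl⟩
        obtain ⟨w, hw⟩ := hdual j
        have h := key w
        simp only [hw, mul_ite, mul_one, mul_zero, ite_smul, zero_smul, Finset.sum_ite_eq',
          Finset.mem_univ, if_true] at h
        rw [SetLike.mem_coe, ← Submodule.smul_mem_iff _ (hb j), ← h]
        exact Submodule.sum_mem _ fun i _ ↦
          Submodule.smul_mem _ _ (Submodule.subset_span ⟨i, rfl⟩)
      · rw [finrank_span_eq_card hx, finrank_span_eq_card hφu]
    have hmem (i : Fin l) : ∃ c : Fin l → k, ∑ j, c j • x j = φ (u i) := by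
      rw [← Submodule.mem_span_range_iff_exists_fun, ← hspan]
      exact Submodule.subset_span ⟨i, rfl⟩
    choose c hc using hmem
    have hgram (j m : Fin l) : ∑ i, a i * c i j * c i m = if m = j then b j else 0 := by
      obtain ⟨w, hw⟩ := hdual j
      have h := key w
      rw [sum_polar_smul_linearCombination Q x (fun i ↦ φ (u i)) a (fun j i ↦ c i j)
        (fun i ↦ (hc i).symm)] at h
      have hm := Fintype.linearIndependent_iffₛ.1 hx _ _ h m
      simp only [hw, mul_ite, mul_one, mul_zero, Finset.sum_ite_eq', Finset.mem_univ,
        if_true] at hm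
      rw [hm]
      split_ifs with hmj
      · rw [hmj]
      · rfl
    refine ⟨φ ∘ u, hspan, fun j i ↦ c i j, fun i ↦ (hc i).symm, fun j ↦ ?_, fun j m hjm ↦ ?_⟩
    · simpa [pow_two, mul_assoc] using (hgram j j).symm
    · simpa [hjm.symm] using hgram j m
  · rintro ⟨x', hspan, α, hx', hdiag, hoff⟩
    have hx'ind : LinearIndependent k x' := by
      rw [linearIndependent_iff_card_eq_finrank_span, Set.finrank, hspan,
        finrank_span_eq_card hx]
    have hx'B (i j : Fin l) : polar Q (x' i) (x' j) = 0 := by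
      simp only [← polarBilin_apply_apply] at hxB ⊢
      simp [hx', hxB]
    obtain ⟨φ, hφ, hφu⟩ := hB.exists_isometry_apply_eq hnd hu hx'ind huB hx'B
    refine ⟨φ, hφ, LinearMap.ext fun w ↦ ?_⟩
    simp only [LinearMap.comp_apply, LinearEquiv.coe_coe,
      prod_reverse_ofFn_sympTransvection_apply Q u a huB,
      prod_reverse_ofFn_sympTransvection_apply Q x b hxB, map_add, map_sum, map_smul,
      LinearEquiv.apply_symm_apply, add_right_inj, hφu]
    have hpolar (i : Fin l) : polar Q (u i) (φ.symm w) = polar Q (x' i) w := by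
      rw [← hφu i, ← polarBilin_apply_apply, ← hφ, LinearEquiv.apply_symm_apply,
        polarBilin_apply_apply]
    simp only [hpolar]
    rw [sum_polar_smul_linearCombination Q x x' a α hx']
    refine Finset.sum_congr rfl fun m _ ↦ ?_
    rw [Finset.sum_eq_single m (fun j _ hjm ↦ by rw [hoff j m hjm, zero_mul]) (by simp),
      hdiag m]
    simp only [pow_two, mul_assoc]
end

section
/- A map of block form (φ, X, δ) is an element of O(q,k) if and only if: φ is a bijective linear map of V_B preserving the bilinear form B restricted to V_B (i.e. B(φ(v), φ(w)) = B(v,w) for all v, w ∈ V_B), δ is a bijective linear map of rad(V) with q(δ(g)) = q(g) for all g ∈ rad(V), and q(w + X(w)) = q(φ(w)) for all w ∈ V_B. -/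
open QuadraticMap

/-- The radical `rad(V) = {v | ∀ w, B(v,w) = 0}` of the bilinear form associated to `Q`. -/
def qRadical {k V : Type*} [Field k] [AddCommGroup V] [Module k V]
    (Q : QuadraticForm k V) : Submodule k V where
  carrier := {v | ∀ w, polar Q v w = 0}
  add_mem' := by
    intro a b ha hb w
    rw [polar_add_left, ha, hb, add_zero]
  zero_mem' := fun w => polar_zero_left Q w
  smul_mem' := by
    intro c v hv w
    rw [polar_smul_left, hv, smul_zero]

/-- The block map `(φ, X, δ) : V → V`, `w + g ↦ φ(w) + X(w) + δ(g)` for `w ∈ V_B`,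
`g ∈ R`, relative to a decomposition `V = V_B ⊕ R`. -/
noncomputable def tripleMap {k V : Type*} [Field k] [AddCommGroup V] [Module k V]
    (VB RD : Submodule k V) (hc : IsCompl VB RD)
    (φ : VB →ₗ[k] VB) (X : VB →ₗ[k] RD) (δ : RD →ₗ[k] RD) : V →ₗ[k] V :=
  VB.subtype ∘ₗ φ ∘ₗ VB.linearProjOfIsCompl RD hc
    + RD.subtype ∘ₗ (X ∘ₗ VB.linearProjOfIsCompl RD hc + δ ∘ₗ RD.linearProjOfIsCompl VB hc.symm)

theorem tripleMap_apply_add {k V : Type*} [Field k] [AddCommGroup V] [Module k V]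
    (VB RD : Submodule k V) (hc : IsCompl VB RD)
    (φ : VB →ₗ[k] VB) (X : VB →ₗ[k] RD) (δ : RD →ₗ[k] RD) (w : VB) (g : RD) :
    tripleMap VB RD hc φ X δ ((w : V) + (g : V)) = (φ w : V) + ((X w + δ g : RD) : V) := by
  simp [tripleMap, Submodule.linearProjOfIsCompl]

/-- A block lower triangular map with injective diagonal blocks is injective. -/
theorem tripleMap_injective {k V : Type*} [Field k] [AddCommGroup V] [Module k V]
    {VB RD : Submodule k V} (hc : IsCompl VB RD)
    {φ : VB →ₗ[k] VB} (X : VB →ₗ[k] RD) {δ : RD →ₗ[k] RD}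
    (hφ : Function.Injective φ) (hδ : Function.Injective δ) :
    Function.Injective (tripleMap VB RD hc φ X δ) := by
  rw [injective_iff_map_eq_zero]
  intro v hv
  obtain ⟨w, g, rfl, -⟩ := Submodule.existsUnique_add_of_isCompl hc v
  rw [tripleMap_apply_add] at hv
  have hφw : φ w = 0 := Subtype.ext <|
    Submodule.disjoint_def.mp hc.disjoint _ (φ w).2
      (by rw [eq_neg_of_add_eq_zero_left hv]; exact RD.neg_mem (SetLike.coe_mem _))
  obtain rfl : w = 0 := hφ (by rw [hφw, map_zero])
  have hδg : δ g = 0 := by simpa using hv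
  obtain rfl : g = 0 := hδ (by rw [hδg, map_zero])
  simp

theorem map_add_of_mem_qRadical {k V : Type*} [Field k] [AddCommGroup V] [Module k V]
    (Q : QuadraticForm k V) (v : V) {r : V} (hr : r ∈ qRadical Q) : Q (v + r) = Q v + Q r := by
  have h : polar Q v r = 0 := by rw [polar_comm]; exact hr v
  rw [QuadraticMap.map_add Q, h, add_zero]

theorem polar_add_add_of_mem_qRadical {k V : Type*} [Field k] [AddCommGroup V] [Module k V]
    (Q : QuadraticForm k V) (v w : V) {r s : V} (hr : r ∈ qRadical Q) (hs : s ∈ qRadical Q) :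
    polar Q (v + r) (w + s) = polar Q v w := by
  have h : polar Q v s = 0 := by rw [polar_comm]; exact hs v
  rw [polar_add_left, hr, polar_add_right, h, add_zero, add_zero]

/-- `(φ, X, δ) ∈ O(q,k)` iff `φ` is a bijective linear map of `V_B`
preserving the restriction of `B`, `δ` is a bijective linear map of `rad(V)` preserving `q`,
and `q(w + X(w)) = q(φ(w))` for all `w ∈ V_B`. -/
theorem tripleMap_mem_orthogonal_iff
    {k V : Type*} [Field k] [CharP k 2] [AddCommGroup V] [Module k V] [FiniteDimensional k V]
    (Q : QuadraticForm k V) (VB : Submodule k V)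
    (hc : IsCompl VB (qRadical Q))
    -- `V_B` is nonsingular
    (hVB : ∀ v ∈ VB, (∀ w ∈ VB, polar Q v w = 0) → v = 0)
    (φ : VB →ₗ[k] VB) (X : VB →ₗ[k] qRadical Q) (δ : qRadical Q →ₗ[k] qRadical Q) :
    (Function.Bijective (tripleMap VB (qRadical Q) hc φ X δ) ∧
      ∀ v : V, Q (tripleMap VB (qRadical Q) hc φ X δ v) = Q v) ↔
    (Function.Bijective φ ∧
      (∀ v w : VB, polar Q (φ v : V) (φ w : V) = polar Q (v : V) (w : V)) ∧
      Function.Bijective δ ∧ (∀ g : qRadical Q, Q (δ g : V) = Q (g : V)) ∧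
      (∀ w : VB, Q ((w : V) + (X w : V)) = Q (φ w : V))) := by
  have hT := tripleMap_apply_add VB (qRadical Q) hc φ X δ
  have hTw (w : VB) : tripleMap VB (qRadical Q) hc φ X δ w = (φ w : V) + (X w : V) := by
    simpa using hT w 0
  have hTg (g : qRadical Q) : tripleMap VB (qRadical Q) hc φ X δ g = (δ g : V) := by
    simpa using hT 0 g
  constructor
  · rintro ⟨hbij, hQ⟩
    have hpolar (v w : VB) : polar Q (φ v : V) (φ w : V) = polar Q (v : V) (w : V) := by
      rw [← polar_add_add_of_mem_qRadical Q (φ v : V) (φ w : V) (X v).2 (X w).2, ← hTw, ← hTw]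
      simp only [polar, ← map_add, hQ]
    have hφ : Function.Injective φ := by
      rw [injective_iff_map_eq_zero]
      intro v hv
      refine Subtype.ext (hVB v v.2 fun w hw => ?_)
      rw [← hpolar v ⟨w, hw⟩, hv, Submodule.coe_zero, polar_zero_left]
    have hδ : Function.Injective δ := fun a b hab =>
      Subtype.ext (hbij.1 (by rw [hTg, hTg, hab]))
    refine ⟨⟨hφ, LinearMap.injective_iff_surjective.mp hφ⟩, hpolar,
      ⟨hδ, LinearMap.injective_iff_surjective.mp hδ⟩, fun g => by rw [← hTg, hQ], fun w => ?_⟩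
    rw [map_add_of_mem_qRadical Q _ (X w).2, ← hQ w, hTw,
      map_add_of_mem_qRadical Q _ (X w).2, add_assoc, CharTwo.add_self_eq_zero, add_zero]
  · rintro ⟨hφ, -, hδ, hδQ, hX⟩
    have hinj := tripleMap_injective hc X hφ.1 hδ.1
    refine ⟨⟨hinj, LinearMap.injective_iff_surjective.mp hinj⟩, fun v => ?_⟩
    obtain ⟨w, g, rfl, -⟩ := Submodule.existsUnique_add_of_isCompl hc v
    rw [hT, Submodule.coe_add, ← add_assoc, map_add_of_mem_qRadical Q _ (δ g).2,
      map_add_of_mem_qRadical Q _ (X w).2, map_add_of_mem_qRadical Q _ g.2, ← hX, hδQ,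
      map_add_of_mem_qRadical Q _ (X w).2, add_assoc (Q w), CharTwo.add_self_eq_zero, add_zero]
end
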